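/- arXiv:0901.3064 — 3 statements merged into one kernel-verified Lean document; each statement's English description precedes it below -/
import Mathlib

section
/- Let n ≥ 1 and consider the space of n-tuples of 2×2 complex matrices. Every function F : (M₂(ℂ))ⁿ → ℂ that is given by a polynomial in the matrix entries and is invariant under simultaneous conjugation by SL(2,ℂ) (i.e. F(g a₁ g⁻¹, …, g aₙ g⁻¹) = F(a₁,…,aₙ) for all g ∈ SL(2,ℂ)) belongs to the ℂ-subalgebra of functions generated by the trace-of-word functions (a₁,…,aₙ) ↦ tr(c₁ c₂ ⋯ c_m), where m ≥ 1 and each letter c_j is either some a_i or the adjugate adj(a_i) of some a_i. -/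
open MvPolynomial Matrix

section CayleyOmega

variable {R : Type*} [CommRing R]

/-- Cayley's Omega operator `∂₀₀∂₁₁ - ∂₀₁∂₁₀` on polynomials in the entries of a `2×2` matrix. -/
noncomputable def cayleyOmega :
    MvPolynomial (Fin 2 × Fin 2) R →ₗ[R] MvPolynomial (Fin 2 × Fin 2) R :=
  (pderiv (R := R) ((0, 0) : Fin 2 × Fin 2)).toLinearMap ∘ₗ
      (pderiv (R := R) ((1, 1) : Fin 2 × Fin 2)).toLinearMap -
    (pderiv (R := R) ((0, 1) : Fin 2 × Fin 2)).toLinearMap ∘ₗ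
      (pderiv (R := R) ((1, 0) : Fin 2 × Fin 2)).toLinearMap

/-- The polarization of `cayleyOmega`, as a derivation in its second argument. -/
noncomputable def cayleyPolar (f : MvPolynomial (Fin 2 × Fin 2) R) :
    Derivation R (MvPolynomial (Fin 2 × Fin 2) R) (MvPolynomial (Fin 2 × Fin 2) R) :=
  pderiv (0, 0) f • pderiv (1, 1) + pderiv (1, 1) f • pderiv (0, 0) -
    pderiv (0, 1) f • pderiv (1, 0) - pderiv (1, 0) f • pderiv (0, 1)

lemma cayleyOmega_apply (f : MvPolynomial (Fin 2 × Fin 2) R) :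
    cayleyOmega f =
      pderiv (0, 0) (pderiv (1, 1) f) - pderiv (0, 1) (pderiv (1, 0) f) := rfl

lemma cayleyPolar_apply (f g : MvPolynomial (Fin 2 × Fin 2) R) :
    cayleyPolar f g =
      pderiv (0, 0) f * pderiv (1, 1) g + pderiv (1, 1) f * pderiv (0, 0) g -
        pderiv (0, 1) f * pderiv (1, 0) g - pderiv (1, 0) f * pderiv (0, 1) g := rfl

lemma cayleyPolar_comm (f g : MvPolynomial (Fin 2 × Fin 2) R) :
    cayleyPolar f g = cayleyPolar g f := by
  simp only [cayleyPolar_apply]; ring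

lemma cayleyOmega_mul (f g : MvPolynomial (Fin 2 × Fin 2) R) :
    cayleyOmega (f * g) = cayleyOmega f * g + f * cayleyOmega g + cayleyPolar f g := by
  simp only [cayleyOmega_apply, cayleyPolar_apply, Derivation.leibniz, map_add, smul_eq_mul]
  ring

lemma cayleyOmega_C (r : R) : cayleyOmega (C r : MvPolynomial (Fin 2 × Fin 2) R) = 0 := by
  simp [cayleyOmega_apply]

lemma det_mvPolynomialX_two :
    (mvPolynomialX (Fin 2) (Fin 2) R).det = X (0, 0) * X (1, 1) - X (0, 1) * X (1, 0) := by
  simp [det_fin_two]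

lemma cayleyPolar_det (f : MvPolynomial (Fin 2 × Fin 2) R) :
    cayleyPolar (mvPolynomialX (Fin 2) (Fin 2) R).det f =
      X (0, 0) * pderiv (0, 0) f + X (1, 1) * pderiv (1, 1) f +
        X (0, 1) * pderiv (0, 1) f + X (1, 0) * pderiv (1, 0) f := by
  simp [det_mvPolynomialX_two, cayleyPolar_apply, Derivation.leibniz, pderiv_X]
  ring

lemma cayleyPolar_det_pow (k : ℕ) :
    cayleyPolar (mvPolynomialX (Fin 2) (Fin 2) R).det
        ((mvPolynomialX (Fin 2) (Fin 2) R).det ^ k) =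
      (2 * k : MvPolynomial (Fin 2 × Fin 2) R) * (mvPolynomialX (Fin 2) (Fin 2) R).det ^ k := by
  have h : cayleyPolar (mvPolynomialX (Fin 2) (Fin 2) R).det
      (mvPolynomialX (Fin 2) (Fin 2) R).det = 2 * (mvPolynomialX (Fin 2) (Fin 2) R).det := by
    rw [cayleyPolar_det]
    simp [det_mvPolynomialX_two, Derivation.leibniz, pderiv_X]
    ring
  induction k with
  | zero => simp
  | succ k ih =>
    rw [pow_succ, Derivation.leibniz, ih, h]
    simp only [smul_eq_mul]
    push_cast
    ring

lemma cayleyOmega_det_pow_succ (k : ℕ) :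
    cayleyOmega ((mvPolynomialX (Fin 2) (Fin 2) R).det ^ (k + 1)) =
      ((k + 1) * (k + 2) : R) • (mvPolynomialX (Fin 2) (Fin 2) R).det ^ k := by
  have h : cayleyOmega (mvPolynomialX (Fin 2) (Fin 2) R).det = 2 := by
    simp [det_mvPolynomialX_two, cayleyOmega_apply, Derivation.leibniz, pderiv_X]
    norm_num
  induction k with
  | zero => simp [h, smul_eq_C_mul, map_ofNat (C (R := R) (σ := Fin 2 × Fin 2)) 2]
  | succ k ih =>
    rw [pow_succ', cayleyOmega_mul, ih, h, cayleyPolar_det_pow]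
    simp only [smul_eq_C_mul, map_mul, map_add, map_natCast, map_one,
      map_ofNat (C (R := R) (σ := Fin 2 × Fin 2)) 2]
    push_cast
    ring

lemma constantCoeff_cayleyOmega_iterate_det_pow (k d : ℕ) :
    constantCoeff (cayleyOmega^[k] ((mvPolynomialX (Fin 2) (Fin 2) R).det ^ d)) =
      if k = d then (k.factorial * (k + 1).factorial : R) else 0 := by
  induction k generalizing d with
  | zero =>
    cases d with
    | zero => simp
    | succ d => simp [det_mvPolynomialX_two]
  | succ k ih =>
    cases d with
    | zero =>
      have h : cayleyOmega (1 : MvPolynomial (Fin 2 × Fin 2) R) = 0 := by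
        rw [← C_1, cayleyOmega_C]
      simp only [Function.iterate_succ_apply, pow_zero, h, ← Module.End.pow_apply, map_zero]
      simp
    | succ d =>
      rw [Function.iterate_succ_apply, cayleyOmega_det_pow_succ, ← Module.End.pow_apply,
        map_smul, Module.End.pow_apply, constantCoeff_smul, ih]
      by_cases h : k = d
      · subst h
        simp only [if_true, smul_eq_mul, Nat.factorial_succ]
        push_cast
        ring
      · simp [h]

/-- The matrix of the standard symplectic form on the plane. -/
def symplecticTwo (S : Type*) [CommRing S] : Matrix (Fin 2) (Fin 2) S := !![0, 1; -1, 0]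

/-- The value of the bilinear form `W J` on the rows `x` and `y` of the generic `2×2` matrix. -/
noncomputable def rowPairing (W : Matrix (Fin 2) (Fin 2) R) (x y : Fin 2) :
    MvPolynomial (Fin 2 × Fin 2) R :=
  (mvPolynomialX (Fin 2) (Fin 2) R * W.map C * symplecticTwo (MvPolynomial (Fin 2 × Fin 2) R) *
    (mvPolynomialX (Fin 2) (Fin 2) R)ᵀ : Matrix (Fin 2) (Fin 2) _) x y

lemma rowPairing_eq (W : Matrix (Fin 2) (Fin 2) R) (x y : Fin 2) :
    rowPairing W x y =
      (X (x, 0) * C (W 0 0) + X (x, 1) * C (W 1 0)) * X (y, 1) -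
        (X (x, 0) * C (W 0 1) + X (x, 1) * C (W 1 1)) * X (y, 0) := by
  simp [rowPairing, symplecticTwo, Matrix.mul_apply, Fin.sum_univ_two]
  ring

lemma constantCoeff_rowPairing (W : Matrix (Fin 2) (Fin 2) R) (x y : Fin 2) :
    constantCoeff (rowPairing W x y) = 0 := by
  simp [rowPairing_eq]

lemma cayleyOmega_rowPairing (W : Matrix (Fin 2) (Fin 2) R) (x y : Fin 2) :
    cayleyOmega (rowPairing W x y) = C (symplecticTwo R x y * W.trace) := by
  fin_cases x <;> fin_cases y <;>
  simp [rowPairing_eq, symplecticTwo, cayleyOmega_apply, Derivation.leibniz, pderiv_X, trace_fin_two]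
  ring

lemma pderiv_rowPairing (W : Matrix (Fin 2) (Fin 2) R) (x y i j : Fin 2) :
    pderiv (i, j) (rowPairing W x y) =
      (if x = i then C (W j 0) * X (y, 1) - C (W j 1) * X (y, 0) else 0) +
        (if y = i then if j = 1 then X (x, 0) * C (W 0 0) + X (x, 1) * C (W 1 0)
          else -(X (x, 0) * C (W 0 1) + X (x, 1) * C (W 1 1)) else 0) := by
  fin_cases j <;> by_cases hx : x = i <;> by_cases hy : y = i <;>
  simp [rowPairing_eq, Derivation.leibniz, pderiv_X, hx, hy] <;> ring

set_option maxHeartbeats 1000000 in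
lemma cayleyPolar_rowPairing (W W' : Matrix (Fin 2) (Fin 2) R) (x y z t : Fin 2) :
    cayleyPolar (rowPairing W x y) (rowPairing W' z t) =
      C (symplecticTwo R x z) * rowPairing (W.adjugate * W') y t -
        C (symplecticTwo R x t) * rowPairing (W.adjugate * W'.adjugate) y z -
        C (symplecticTwo R y z) * rowPairing (W * W') x t +
        C (symplecticTwo R y t) * rowPairing (W * W'.adjugate) x z := by
  fin_cases x <;> fin_cases y <;> fin_cases z <;> fin_cases t <;>
  simp only [cayleyPolar_apply, pderiv_rowPairing] <;>
  simp only [rowPairing_eq, Matrix.mul_apply, Fin.sum_univ_two] <;>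
  simp [symplecticTwo, adjugate_fin_two] <;> ring

lemma mvPolynomialX_mul_mul_adjugate (W : Matrix (Fin 2) (Fin 2) R) (x y : Fin 2) :
    (mvPolynomialX (Fin 2) (Fin 2) R * W.map C * (mvPolynomialX (Fin 2) (Fin 2) R).adjugate :
        Matrix (Fin 2) (Fin 2) _) x y =
      rowPairing W x 0 * C (symplecticTwo R y 0) + rowPairing W x 1 * C (symplecticTwo R y 1) := by
  fin_cases y <;>
  simp [rowPairing_eq, symplecticTwo, adjugate_fin_two, Matrix.mul_apply, Fin.sum_univ_two] <;>
  ring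

variable {k : Type*} [CommRing k] [Algebra k R]

/-- The algebra generated by constants from `T` and by the pairings of rows by matrices
from `𝒲`. -/
noncomputable def pairingAlgebra (T : Subalgebra k R) (𝒲 : Submonoid (Matrix (Fin 2) (Fin 2) R)) :
    Subalgebra k (MvPolynomial (Fin 2 × Fin 2) R) :=
  Algebra.adjoin k ({p | ∃ r ∈ T, p = C r} ∪ {p | ∃ W ∈ 𝒲, ∃ x y, p = rowPairing W x y})

variable {T : Subalgebra k R} {𝒲 : Submonoid (Matrix (Fin 2) (Fin 2) R)}

lemma C_mem_pairingAlgebra {r : R} (hr : r ∈ T) : C r ∈ pairingAlgebra T 𝒲 :=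
  Algebra.subset_adjoin (Or.inl ⟨r, hr, rfl⟩)

lemma rowPairing_mem_pairingAlgebra {W : Matrix (Fin 2) (Fin 2) R} (hW : W ∈ 𝒲) (x y : Fin 2) :
    rowPairing W x y ∈ pairingAlgebra T 𝒲 :=
  Algebra.subset_adjoin (Or.inr ⟨W, hW, x, y, rfl⟩)

lemma symplecticTwo_mem (x y : Fin 2) : symplecticTwo R x y ∈ T := by
  fin_cases x <;> fin_cases y <;> simp [symplecticTwo, T.zero_mem, T.one_mem, T.neg_mem]

lemma constantCoeff_mem_of_mem_pairingAlgebra {p : MvPolynomial (Fin 2 × Fin 2) R}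
    (hp : p ∈ pairingAlgebra T 𝒲) : constantCoeff p ∈ T := by
  induction hp using Algebra.adjoin_induction with
  | mem p hp =>
    rcases hp with ⟨r, hr, rfl⟩ | ⟨W, -, x, y, rfl⟩
    · simpa using hr
    · simp [constantCoeff_rowPairing, T.zero_mem]
  | algebraMap c =>
    rw [MvPolynomial.algebraMap_apply, constantCoeff_C]
    exact T.algebraMap_mem c
  | add p q _ _ hp hq => rw [map_add]; exact T.add_mem hp hq
  | mul p q _ _ hp hq => rw [map_mul]; exact T.mul_mem hp hq

lemma cayleyPolar_mem_pairingAlgebra (hadj : ∀ W ∈ 𝒲, W.adjugate ∈ 𝒲)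
    {p q : MvPolynomial (Fin 2 × Fin 2) R}
    (hp : p ∈ pairingAlgebra T 𝒲) (hq : q ∈ pairingAlgebra T 𝒲) :
    cayleyPolar p q ∈ pairingAlgebra T 𝒲 := by
  have extend (f : MvPolynomial (Fin 2 × Fin 2) R)
      (hf : ∀ W ∈ 𝒲, ∀ x y, cayleyPolar f (rowPairing W x y) ∈ pairingAlgebra T 𝒲)
      {q : MvPolynomial (Fin 2 × Fin 2) R} (hq : q ∈ pairingAlgebra T 𝒲) :
      cayleyPolar f q ∈ pairingAlgebra T 𝒲 := by
    induction hq using Algebra.adjoin_induction with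
    | mem p hp =>
      rcases hp with ⟨r, hr, rfl⟩ | ⟨W, hW, x, y, rfl⟩
      · simp
      · exact hf W hW x y
    | algebraMap c => simp [MvPolynomial.algebraMap_apply]
    | add p q _ _ hp hq => rw [map_add]; exact Subalgebra.add_mem _ hp hq
    | mul p q hp' hq' hp hq =>
      rw [Derivation.leibniz]
      exact Subalgebra.add_mem _ (Subalgebra.mul_mem _ hp' hq) (Subalgebra.mul_mem _ hq' hp)
  refine extend p (fun W hW x y => ?_) hq
  rw [cayleyPolar_comm]
  refine extend _ (fun W' hW' z t => ?_) hp
  have key (U : Matrix (Fin 2) (Fin 2) R) (hU : U ∈ 𝒲) (i j i' j' : Fin 2) :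
      C (symplecticTwo R i j) * rowPairing U i' j' ∈ pairingAlgebra T 𝒲 :=
    Subalgebra.mul_mem _ (C_mem_pairingAlgebra (symplecticTwo_mem i j))
      (rowPairing_mem_pairingAlgebra hU i' j')
  rw [cayleyPolar_rowPairing]
  exact Subalgebra.add_mem _ (Subalgebra.sub_mem _ (Subalgebra.sub_mem _
    (key _ (mul_mem (hadj W hW) hW') _ _ _ _)
    (key _ (mul_mem (hadj W hW) (hadj W' hW')) _ _ _ _))
    (key _ (mul_mem hW hW') _ _ _ _)) (key _ (mul_mem hW (hadj W' hW')) _ _ _ _)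

lemma cayleyOmega_mem_pairingAlgebra (hadj : ∀ W ∈ 𝒲, W.adjugate ∈ 𝒲)
    (htr : ∀ W ∈ 𝒲, W.trace ∈ T) {p : MvPolynomial (Fin 2 × Fin 2) R}
    (hp : p ∈ pairingAlgebra T 𝒲) : cayleyOmega p ∈ pairingAlgebra T 𝒲 := by
  induction hp using Algebra.adjoin_induction with
  | mem p hp =>
    rcases hp with ⟨r, hr, rfl⟩ | ⟨W, hW, x, y, rfl⟩
    · simp [cayleyOmega_C]
    · rw [cayleyOmega_rowPairing]
      exact C_mem_pairingAlgebra (T.mul_mem (symplecticTwo_mem x y) (htr W hW))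
  | algebraMap c => simp [MvPolynomial.algebraMap_apply, cayleyOmega_C]
  | add p q _ _ hp hq => rw [map_add]; exact Subalgebra.add_mem _ hp hq
  | mul p q hp' hq' hp hq =>
    rw [cayleyOmega_mul]
    exact Subalgebra.add_mem _ (Subalgebra.add_mem _ (Subalgebra.mul_mem _ hp hq')
      (Subalgebra.mul_mem _ hp' hq)) (cayleyPolar_mem_pairingAlgebra hadj hp' hq')

/-- If a combination `∑ det(g)ᵈ f_d` lies in the pairing algebra, its coefficients lie in `T`. -/
lemma mem_of_sum_det_pow_mem_pairingAlgebra {k : Type*} [Field k] [CharZero k] [Algebra k R]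
    {T : Subalgebra k R} (hadj : ∀ W ∈ 𝒲, W.adjugate ∈ 𝒲) (htr : ∀ W ∈ 𝒲, W.trace ∈ T)
    (s : Finset ℕ) (f : ℕ → R)
    (h : ∑ d ∈ s, f d • (mvPolynomialX (Fin 2) (Fin 2) R).det ^ d ∈ pairingAlgebra T 𝒲)
    {e : ℕ} (he : e ∈ s) : f e ∈ T := by
  have hiter (j : ℕ) : cayleyOmega^[j]
      (∑ d ∈ s, f d • (mvPolynomialX (Fin 2) (Fin 2) R).det ^ d) ∈ pairingAlgebra T 𝒲 := by
    induction j with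
    | zero => exact h
    | succ j ih =>
      rw [Function.iterate_succ_apply']
      exact cayleyOmega_mem_pairingAlgebra hadj htr ih
  have hmem := constantCoeff_mem_of_mem_pairingAlgebra (hiter e)
  rw [← Module.End.pow_apply, map_sum, map_sum] at hmem
  simp only [map_smul, Module.End.pow_apply, constantCoeff_smul,
    constantCoeff_cayleyOmega_iterate_det_pow, smul_eq_mul, mul_ite, mul_zero,
    Finset.sum_ite_eq, he, if_true] at hmem
  have hc : (e.factorial * (e + 1).factorial : k) ≠ 0 := by
    exact_mod_cast mul_ne_zero e.factorial_ne_zero (e + 1).factorial_ne_zero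
  have hsmul := T.smul_mem hmem (e.factorial * (e + 1).factorial : k)⁻¹
  have heq : f e * (e.factorial * (e + 1).factorial : R) =
      (e.factorial * (e + 1).factorial : k) • f e := by
    rw [Algebra.smul_def]
    simp [mul_comm]
  rwa [heq, inv_smul_smul₀ hc] at hsmul

end CayleyOmega

section TraceWords

variable {ι : Type*}

/-- The letter `a i` or `adj (a i)`, as a matrix of functions of the tuple `a`. -/
def genericLetter (v : ι × Bool) :
    Matrix (Fin 2) (Fin 2) ((ι → Matrix (Fin 2) (Fin 2) ℂ) → ℂ) :=
  Matrix.of fun x y a => (if v.2 then a v.1 else (a v.1).adjugate) x y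

/-- The monoid of words in the generic matrices and their adjugates. -/
def genericWords (ι : Type*) :
    Submonoid (Matrix (Fin 2) (Fin 2) ((ι → Matrix (Fin 2) (Fin 2) ℂ) → ℂ)) :=
  Submonoid.closure (Set.range genericLetter)

lemma adjugate_genericLetter (v : ι × Bool) :
    (genericLetter v).adjugate = genericLetter (v.1, !v.2) := by
  obtain ⟨i, b⟩ := v
  ext x y a
  cases b <;> fin_cases x <;> fin_cases y <;> simp [genericLetter, adjugate_fin_two]

lemma adjugate_mem_genericWords
    {W : Matrix (Fin 2) (Fin 2) ((ι → Matrix (Fin 2) (Fin 2) ℂ) → ℂ)} (hW : W ∈ genericWords ι) :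
    W.adjugate ∈ genericWords ι := by
  induction hW using Submonoid.closure_induction with
  | mem W hW =>
    obtain ⟨v, rfl⟩ := hW
    rw [adjugate_genericLetter]
    exact Submonoid.subset_closure ⟨_, rfl⟩
  | one => rw [adjugate_one]; exact one_mem _
  | mul U W _ _ hU hW => rw [adjugate_mul_distrib]; exact mul_mem hW hU

lemma trace_mem_adjoin_of_mem_genericWords
    {W : Matrix (Fin 2) (Fin 2) ((ι → Matrix (Fin 2) (Fin 2) ℂ) → ℂ)} (hW : W ∈ genericWords ι) :
    W.trace ∈ Algebra.adjoin ℂ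
      {f : (ι → Matrix (Fin 2) (Fin 2) ℂ) → ℂ |
        ∃ m : ℕ, 1 ≤ m ∧ ∃ w : Fin m → ι × Bool,
          f = fun a => Matrix.trace
            (List.ofFn (fun j : Fin m =>
              if (w j).2 then a (w j).1 else Matrix.adjugate (a (w j).1))).prod} := by
  obtain ⟨l, rfl⟩ : ∃ l : List (ι × Bool), (l.map genericLetter).prod = W := by
    obtain ⟨L, hL, rfl⟩ := Submonoid.exists_list_of_mem_closure hW
    obtain ⟨l, rfl⟩ : L ∈ Set.range (List.map (genericLetter (ι := ι))) := by
      rw [Set.range_list_map]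
      exact hL
    exact ⟨l, rfl⟩
  rcases l.eq_nil_or_concat with rfl | hl
  · have h2 : ((List.map genericLetter ([] : List (ι × Bool))).prod).trace =
        (2 : (ι → Matrix (Fin 2) (Fin 2) ℂ) → ℂ) := by
      simp
    rw [h2]
    exact ofNat_mem _ 2
  · refine Algebra.subset_adjoin ⟨l.length, ?_, l.get, ?_⟩
    · obtain ⟨l', b, rfl⟩ := hl
      simp
    · funext a
      have hmap : ((l.map genericLetter).prod).map (Pi.evalRingHom (fun _ => ℂ) a) =
          (l.map fun v => if v.2 then a v.1 else (a v.1).adjugate).prod := by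
        rw [← RingHom.mapMatrix_apply, map_list_prod, List.map_map]
        rfl
      have hofFn : List.ofFn (fun j : Fin l.length =>
          if (l.get j).2 then a (l.get j).1 else (a (l.get j).1).adjugate) =
          l.map fun v => if v.2 then a v.1 else (a v.1).adjugate := by
        conv_rhs => rw [← List.ofFn_get l, List.map_ofFn]
        rfl
      rw [hofFn, ← hmap]
      simp [trace_fin_two]

/-- Polynomials whose coefficients are functions agree if they agree pointwise on invertible
matrices. -/
lemma mvPolynomial_ext_of_eval_invertible {α : Type*} {p q : MvPolynomial (Fin 2 × Fin 2) (α → ℂ)}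
    (h : ∀ (a : α) (g : Matrix (Fin 2) (Fin 2) ℂ), g.det ≠ 0 →
      eval₂Hom (Pi.evalRingHom (fun _ => ℂ) a) (fun s => g s.1 s.2) p =
        eval₂Hom (Pi.evalRingHom (fun _ => ℂ) a) (fun s => g s.1 s.2) q) : p = q := by
  have hmap (a : α) : map (Pi.evalRingHom (fun _ => ℂ) a) p =
      map (Pi.evalRingHom (fun _ => ℂ) a) q := by
    refine mul_right_cancel₀ (det_mvPolynomialX_ne_zero (Fin 2) ℂ) (MvPolynomial.funext fun v => ?_)
    have hdet : eval v (mvPolynomialX (Fin 2) (Fin 2) ℂ).det =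
        (Matrix.of fun i j => v (i, j)).det := by
      simp [det_fin_two]
    rw [map_mul, map_mul, hdet]
    by_cases hv : (Matrix.of fun i j => v (i, j)).det = 0
    · simp [hv]
    · congr 1
      simpa [eval_map] using h a _ hv
  ext m a
  simpa [coeff_map] using congrArg (coeff m) (hmap a)

/-- A function invariant under conjugation by `SL(2,ℂ)` satisfies `F(g a adj(g)) = F(det(g) a)`. -/
lemma apply_mul_mul_adjugate_of_invariant {F : (ι → Matrix (Fin 2) (Fin 2) ℂ) → ℂ}
    (hinv : ∀ g : Matrix.SpecialLinearGroup (Fin 2) ℂ,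
      ∀ a : ι → Matrix (Fin 2) (Fin 2) ℂ,
        F (fun i => (g : Matrix (Fin 2) (Fin 2) ℂ) * a i *
          ((g⁻¹ : Matrix.SpecialLinearGroup (Fin 2) ℂ) : Matrix (Fin 2) (Fin 2) ℂ)) = F a)
    (a : ι → Matrix (Fin 2) (Fin 2) ℂ) {g : Matrix (Fin 2) (Fin 2) ℂ} (hg : g.det ≠ 0) :
    F (fun i => g * a i * g.adjugate) = F (fun i => g.det • a i) := by
  obtain ⟨s, hs⟩ := IsAlgClosed.exists_pow_nat_eq g.det (n := 2) (by norm_num)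
  have hs0 : s ≠ 0 := by
    rintro rfl
    simp at hs
    exact hg hs.symm
  have hdet : (s⁻¹ • g).det = 1 := by
    rw [det_smul, Fintype.card_fin, ← hs, inv_pow, inv_mul_cancel₀ (pow_ne_zero 2 hs0)]
  let h : Matrix.SpecialLinearGroup (Fin 2) ℂ := ⟨s⁻¹ • g, hdet⟩
  have hcoe : (h : Matrix (Fin 2) (Fin 2) ℂ) = s⁻¹ • g := rfl
  rw [← hinv h (fun i => g.det • a i)]
  congr 1
  funext i
  rw [Matrix.SpecialLinearGroup.coe_inv, hcoe, adjugate_smul, ← hs]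
  simp only [Fintype.card_fin, Matrix.smul_mul, Matrix.mul_smul, smul_smul]
  rw [show s⁻¹ ^ (2 - 1) * (s ^ 2 * s⁻¹) = 1 by norm_num; field_simp, one_smul]

lemma eval_smul_of_isHomogeneous {S σ : Type*} [CommSemiring S] [Fintype σ] {d : ℕ}
    {p : MvPolynomial σ S} (hp : p.IsHomogeneous d) (c : S) (v : σ → S) :
    eval (fun i => c * v i) p = c ^ d * eval v p := by
  rw [eval_eq', eval_eq', Finset.mul_sum]
  refine Finset.sum_congr rfl fun m hm => ?_
  have hdeg : ∑ i, m i = d := by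
    rw [← Finsupp.degree_eq_sum, Finsupp.degree_eq_weight_one]
    exact hp (mem_support_iff.mp hm)
  simp only [mul_pow, Finset.prod_mul_distrib, Finset.prod_pow_eq_pow_sum, hdeg]
  ring

end TraceWords


/-- Every polynomial function on `n`-tuples of `2×2` complex matrices that is invariant
under simultaneous conjugation by `SL(2,ℂ)` belongs to the subalgebra generated by
the functions `a ↦ tr(c₁ ⋯ c_m)` where each letter `c_j` is some `a_i` or some `adj(a_i)`. -/
theorem invariant_poly_generated_by_trace_words (n : ℕ) (hn : 1 ≤ n)
    (F : (Fin n → Matrix (Fin 2) (Fin 2) ℂ) → ℂ)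
    (hpoly : ∃ P : MvPolynomial (Fin n × Fin 2 × Fin 2) ℂ,
      ∀ a : Fin n → Matrix (Fin 2) (Fin 2) ℂ,
        F a = MvPolynomial.eval (fun v => a v.1 v.2.1 v.2.2) P)
    (hinv : ∀ g : Matrix.SpecialLinearGroup (Fin 2) ℂ,
      ∀ a : Fin n → Matrix (Fin 2) (Fin 2) ℂ,
        F (fun i => (g : Matrix (Fin 2) (Fin 2) ℂ) * a i *
          ((g⁻¹ : Matrix.SpecialLinearGroup (Fin 2) ℂ) : Matrix (Fin 2) (Fin 2) ℂ)) = F a) :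
    F ∈ Algebra.adjoin ℂ
      {f : (Fin n → Matrix (Fin 2) (Fin 2) ℂ) → ℂ |
        ∃ m : ℕ, 1 ≤ m ∧ ∃ w : Fin m → Fin n × Bool,
          f = fun a => Matrix.trace
            (List.ofFn (fun j : Fin m =>
              if (w j).2 then a (w j).1 else Matrix.adjugate (a (w j).1))).prod} := by
  obtain ⟨P, hP⟩ := hpoly
  set T := Algebra.adjoin ℂ
      {f : (Fin n → Matrix (Fin 2) (Fin 2) ℂ) → ℂ |
        ∃ m : ℕ, 1 ≤ m ∧ ∃ w : Fin m → Fin n × Bool,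
          f = fun a => Matrix.trace
            (List.ofFn (fun j : Fin m =>
              if (w j).2 then a (w j).1 else Matrix.adjugate (a (w j).1))).prod}
  let entry (v : Fin n × Fin 2 × Fin 2) :
      MvPolynomial (Fin 2 × Fin 2) ((Fin n → Matrix (Fin 2) (Fin 2) ℂ) → ℂ) :=
    (mvPolynomialX (Fin 2) (Fin 2) _ * (genericLetter (v.1, true)).map C *
      (mvPolynomialX (Fin 2) (Fin 2) _).adjugate : Matrix (Fin 2) (Fin 2) _) v.2.1 v.2.2
  let Fd (d : ℕ) (a : Fin n → Matrix (Fin 2) (Fin 2) ℂ) : ℂ :=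
    eval (fun v => a v.1 v.2.1 v.2.2) (homogeneousComponent d P)
  have hF : F = ∑ d ∈ Finset.range (P.totalDegree + 1), Fd d := by
    funext a
    rw [hP, Finset.sum_apply, ← map_sum, sum_homogeneousComponent]
  have hmem : aeval entry P ∈ pairingAlgebra T (genericWords (Fin n)) := by
    have hentry (v : Fin n × Fin 2 × Fin 2) :
        entry v ∈ pairingAlgebra T (genericWords (Fin n)) := by
      have hW : genericLetter (v.1, true) ∈ genericWords (Fin n) :=
        Submonoid.subset_closure ⟨_, rfl⟩
      simp only [entry, mvPolynomialX_mul_mul_adjugate]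
      exact Subalgebra.add_mem _
        (Subalgebra.mul_mem _ (rowPairing_mem_pairingAlgebra hW _ _)
          (C_mem_pairingAlgebra (symplecticTwo_mem _ _)))
        (Subalgebra.mul_mem _ (rowPairing_mem_pairingAlgebra hW _ _)
          (C_mem_pairingAlgebra (symplecticTwo_mem _ _)))
    exact eval₂_mem (fun _ _ => Subalgebra.algebraMap_mem _ _) hentry
  have hdet : aeval entry P = ∑ d ∈ Finset.range (P.totalDegree + 1),
      Fd d • (mvPolynomialX (Fin 2) (Fin 2) _).det ^ d := by
    refine mvPolynomial_ext_of_eval_invertible fun a g hg => ?_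
    have hleft : eval₂Hom (Pi.evalRingHom (fun _ => ℂ) a) (fun s => g s.1 s.2) (aeval entry P) =
        F (fun i => g * a i * g.adjugate) := by
      have hcoeff : (eval₂Hom (Pi.evalRingHom (fun _ => ℂ) a) fun s => g s.1 s.2).comp
          (algebraMap ℂ (MvPolynomial (Fin 2 × Fin 2) _)) = RingHom.id ℂ := by
        refine RingHom.ext fun c => ?_
        rw [RingHom.comp_apply, MvPolynomial.algebraMap_apply]
        simp
      rw [hP, map_aeval, hcoeff]
      congr 2
      funext v
      obtain ⟨i, x, y⟩ := v
      fin_cases x <;> fin_cases y <;>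
      simp [entry, genericLetter, adjugate_fin_two, Matrix.mul_apply, Fin.sum_univ_two]
    rw [hleft, apply_mul_mul_adjugate_of_invariant hinv a hg, hF, Finset.sum_apply, map_sum]
    refine Finset.sum_congr rfl fun d _ => ?_
    have hhom : Fd d (fun i => g.det • a i) = g.det ^ d * Fd d a := by
      simp only [Fd]
      rw [← eval_smul_of_isHomogeneous (homogeneousComponent_isHomogeneous d P)]
      simp
    rw [hhom, smul_eq_C_mul, map_mul, map_pow, mul_comm]
    simp [det_fin_two]
  rw [hF]
  exact Subalgebra.sum_mem _ fun d hd => mem_of_sum_det_pow_mem_pairingAlgebra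
    (fun _ => adjugate_mem_genericWords) (fun _ => trace_mem_adjoin_of_mem_genericWords) _ Fd
    (hdet ▸ hmem) hd
end

section
/- Let V = ℂ² and n ≥ 0. For each integer k with 0 ≤ k ≤ n and k ≡ n (mod 2), let Mult_{n,k} be the linear subspace of the space Mult_n of n-multilinear maps Vⁿ → ℂ spanned by the maps (x₁,…,xₙ) ↦ P(x_{σ(1)}, …, x_{σ(k)}) · ω(x_{σ(k+1)}, x_{σ(k+2)}) ⋯ ω(x_{σ(n−1)}, x_{σ(n)}), where σ ranges over all permutations of {1,…,n} and P ranges over all symmetric k-multilinear maps V^k → ℂ. Then Mult_n is the internal direct sum of the subspaces Mult_{n,k}: these subspaces are linearly independent and together span Mult_n. -/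
namespace SymplecticMultilinear

/-- The standard symplectic form on `ℂ²`. -/
def omega (u v : Fin 2 → ℂ) : ℂ := u 0 * v 1 - u 1 * v 0

/-- Extension of a finite family of vectors by zero. -/
def extend {n : ℕ} (z : Fin n → Fin 2 → ℂ) (i : ℕ) : Fin 2 → ℂ :=
  if h : i < n then z ⟨i, h⟩ else 0

/-- `Q(z₀, …, z_{k-1}) ω(z_k, z_{k+1}) ⋯ ω(z_{n-2}, z_{n-1})`. -/
def prodForm {n : ℕ} (k : ℕ) (Q : MultilinearMap ℂ (fun _ : Fin k => (Fin 2 → ℂ)) ℂ)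
    (z : Fin n → Fin 2 → ℂ) : ℂ :=
  Q (fun i => extend z i) *
    ∏ j ∈ Finset.range ((n - k) / 2), omega (extend z (k + 2 * j)) (extend z (k + 2 * j + 1))

/-- The maps generating the isotypical component of degree `k`. -/
def generators (n k : ℕ) : Set (MultilinearMap ℂ (fun _ : Fin n => (Fin 2 → ℂ)) ℂ) :=
  {L | ∃ σ : Equiv.Perm (Fin n),
    ∃ P : MultilinearMap ℂ (fun _ : Fin k => (Fin 2 → ℂ)) ℂ,
      (∀ τ : Equiv.Perm (Fin k), ∀ y : Fin k → (Fin 2 → ℂ), P (y ∘ τ) = P y) ∧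
      ∀ x, L x = prodForm k P (x ∘ σ)}

theorem extend_of_lt {n i : ℕ} (z : Fin n → Fin 2 → ℂ) (h : i < n) :
    extend z i = z ⟨i, h⟩ := dif_pos h

theorem bilin_sub_swap (B : (Fin 2 → ℂ) →ₗ[ℂ] (Fin 2 → ℂ) →ₗ[ℂ] ℂ) (u v : Fin 2 → ℂ) :
    B u v - B v u = omega u v *
      (B (Pi.single 0 1) (Pi.single 1 1) - B (Pi.single 1 1) (Pi.single 0 1)) := by
  have key (w : Fin 2 → ℂ) :
      w = w 0 • (Pi.single 0 1 : Fin 2 → ℂ) + w 1 • (Pi.single 1 1 : Fin 2 → ℂ) := by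
    ext i; fin_cases i <;> simp
  generalize (Pi.single 0 1 : Fin 2 → ℂ) = e at key ⊢
  generalize (Pi.single 1 1 : Fin 2 → ℂ) = f at key ⊢
  have h (u v : Fin 2 → ℂ) : B u v = u 0 * v 0 * B e e + u 0 * v 1 * B e f
      + u 1 * v 0 * B f e + u 1 * v 1 * B f f := by
    conv_lhs => rw [key u, key v]
    simp only [map_add, map_smul, LinearMap.add_apply, LinearMap.smul_apply, smul_eq_mul]
    ring
  rw [h u v, h v u, omega]
  ring

/-- The extension of a permutation of the first `k` indices to all `n` indices. -/
def liftPerm {n k : ℕ} (hk : k ≤ n) (ρ : Equiv.Perm (Fin k)) : Equiv.Perm (Fin n) :=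
  ρ.viaFintypeEmbedding (Fin.castLEEmb hk)

theorem liftPerm_castLE {n k : ℕ} (hk : k ≤ n) (ρ : Equiv.Perm (Fin k)) (i : Fin k) :
    liftPerm hk ρ (Fin.castLE hk i) = Fin.castLE hk (ρ i) :=
  Equiv.Perm.viaFintypeEmbedding_apply_image ρ (Fin.castLEEmb hk) i

theorem liftPerm_of_le {n k : ℕ} (hk : k ≤ n) (ρ : Equiv.Perm (Fin k)) (i : Fin n)
    (hi : k ≤ i) : liftPerm hk ρ i = i := by
  refine Equiv.Perm.viaFintypeEmbedding_apply_notMem_range ρ (Fin.castLEEmb hk) ?_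
  rintro ⟨j, rfl⟩
  have := j.isLt
  simp at hi
  omega

theorem liftPerm_mul {n k : ℕ} (hk : k ≤ n) (ρ τ : Equiv.Perm (Fin k)) :
    liftPerm hk (ρ * τ) = liftPerm hk ρ * liftPerm hk τ := by
  ext i : 1
  by_cases hi : k ≤ i
  · simp [liftPerm_of_le hk _ i hi]
  · obtain ⟨j, rfl⟩ : ∃ j, i = Fin.castLE hk j := ⟨⟨i, by omega⟩, rfl⟩
    simp [liftPerm_castLE]

theorem liftPerm_swap {n k : ℕ} (hk : k ≤ n) (i j : Fin k) :
    liftPerm hk (Equiv.swap i j) = Equiv.swap (Fin.castLE hk i) (Fin.castLE hk j) := by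
  ext l : 1
  by_cases hl : k ≤ l
  · rw [liftPerm_of_le hk _ l hl, Equiv.swap_apply_of_ne_of_ne]
    · rintro rfl; simp at hl; omega
    · rintro rfl; simp at hl; omega
  · obtain ⟨l, rfl⟩ : ∃ j, l = Fin.castLE hk j := ⟨⟨l, by omega⟩, rfl⟩
    rw [liftPerm_castLE]
    exact (Fin.castLE_injective hk).map_swap i j l

theorem prodForm_comp_liftPerm {n k : ℕ} (hk : k ≤ n)
    (Q : MultilinearMap ℂ (fun _ : Fin k => (Fin 2 → ℂ)) ℂ) (ρ : Equiv.Perm (Fin k))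
    (z : Fin n → Fin 2 → ℂ) :
    prodForm k Q (z ∘ liftPerm hk ρ) = prodForm k (Q.domDomCongr ρ) z := by
  have h1 (i : Fin k) : extend (z ∘ liftPerm hk ρ) i = extend z (ρ i) := by
    rw [extend_of_lt _ (by omega), extend_of_lt _ (by omega)]
    exact congrArg z (liftPerm_castLE hk ρ i)
  have h2 (i : ℕ) (hi : k ≤ i) : extend (z ∘ liftPerm hk ρ) i = extend z i := by
    unfold extend
    split_ifs with h
    · exact congrArg z (liftPerm_of_le hk ρ ⟨i, h⟩ hi)
    · rfl
  unfold prodForm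
  rw [MultilinearMap.domDomCongr_apply]
  congr 1
  · simp_rw [h1]
  · exact Finset.prod_congr rfl fun j _ => by rw [h2 _ (by omega), h2 _ (by omega)]

/-- The contraction of the last two arguments with the symplectic form. -/
noncomputable def contract {k : ℕ} (Q : MultilinearMap ℂ (fun _ : Fin (k + 2) => (Fin 2 → ℂ)) ℂ) :
    MultilinearMap ℂ (fun _ : Fin k => (Fin 2 → ℂ)) ℂ :=
  let R (u v : Fin 2 → ℂ) : MultilinearMap ℂ (fun _ : Fin k => (Fin 2 → ℂ)) ℂ :=
    (LinearMap.applyₗ v ∘ₗ LinearMap.applyₗ u).compMultilinearMap Q.curryRight.curryRight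
  R (Pi.single 0 1) (Pi.single 1 1) - R (Pi.single 1 1) (Pi.single 0 1)

theorem sub_swap_last {k : ℕ} (Q : MultilinearMap ℂ (fun _ : Fin (k + 2) => (Fin 2 → ℂ)) ℂ)
    (y : Fin (k + 2) → Fin 2 → ℂ) :
    Q y - Q (y ∘ Equiv.swap (Fin.last k).castSucc (Fin.last (k + 1))) =
      omega (y (Fin.last k).castSucc) (y (Fin.last (k + 1))) *
        contract Q (fun i => y i.castSucc.castSucc) := by
  refine Eq.trans ?_ (bilin_sub_swap
    (Q.curryRight.curryRight fun i => y i.castSucc.castSucc) _ _)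
  simp only [MultilinearMap.curryRight_apply]
  congr 2 <;> funext i <;> induction i using Fin.lastCases with
  | last => simp
  | cast i =>
    induction i using Fin.lastCases with
    | last => simp
    | cast i =>
      simp [Equiv.swap_apply_of_ne_of_ne, Fin.castSucc_ne_last]

theorem prodForm_sub_swap {n k : ℕ} (hk : k + 2 ≤ n)
    (Q : MultilinearMap ℂ (fun _ : Fin (k + 2) => (Fin 2 → ℂ)) ℂ) (z : Fin n → Fin 2 → ℂ) :
    prodForm (k + 2) Q z - prodForm (k + 2)
        (Q.domDomCongr (Equiv.swap (Fin.last k).castSucc (Fin.last (k + 1)))) z =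
      prodForm k (contract Q) z := by
  unfold prodForm
  rw [← sub_mul, MultilinearMap.domDomCongr_apply]
  have h := sub_swap_last Q (fun i => extend z i)
  have e : (n - k) / 2 = (n - (k + 2)) / 2 + 1 := by omega
  rw [e, Finset.prod_range_succ']
  simp only [Function.comp_def, Fin.val_castSucc, Fin.val_last] at h
  rw [h]
  have h3 (j : ℕ) : k + 2 * (j + 1) = k + 2 + 2 * j := by ring
  simp only [h3, mul_zero, add_zero]
  ring

theorem prodForm_swap_pair {n k : ℕ} (Q : MultilinearMap ℂ (fun _ : Fin k => (Fin 2 → ℂ)) ℂ)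
    (z : Fin n → Fin 2 → ℂ) (p : ℕ) (hp : k + 2 * p + 1 < n) :
    prodForm k Q (z ∘ Equiv.swap ⟨k + 2 * p, by omega⟩ ⟨k + 2 * p + 1, hp⟩) =
      - prodForm k Q z := by
  have h1 (i : ℕ) (h : i ≠ k + 2 * p) (h' : i ≠ k + 2 * p + 1) :
      extend (z ∘ Equiv.swap ⟨k + 2 * p, by omega⟩ ⟨k + 2 * p + 1, hp⟩) i = extend z i := by
    unfold extend
    split_ifs with hi
    · rw [Function.comp_apply, Equiv.swap_apply_of_ne_of_ne] <;> simpa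
    · rfl
  have h2 : extend (z ∘ Equiv.swap ⟨k + 2 * p, by omega⟩ ⟨k + 2 * p + 1, hp⟩) (k + 2 * p) =
      extend z (k + 2 * p + 1) := by
    rw [extend_of_lt _ (by omega), extend_of_lt _ (by omega)]; simp
  have h3 : extend (z ∘ Equiv.swap ⟨k + 2 * p, by omega⟩ ⟨k + 2 * p + 1, hp⟩) (k + 2 * p + 1) =
      extend z (k + 2 * p) := by
    rw [extend_of_lt _ (by omega), extend_of_lt _ (by omega)]; simp
  have hmem : p ∈ Finset.range ((n - k) / 2) := by rw [Finset.mem_range]; omega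
  unfold prodForm
  rw [← Finset.mul_prod_erase _ _ hmem, ← Finset.mul_prod_erase _ _ hmem, h2, h3]
  have h4 : ∀ i : Fin k, extend (z ∘ Equiv.swap ⟨k + 2 * p, by omega⟩ ⟨k + 2 * p + 1, hp⟩) i
      = extend z i := fun i => h1 i (by omega) (by omega)
  simp_rw [h4]
  rw [Finset.prod_congr rfl (g := fun j => omega (extend z (k + 2 * j)) (extend z (k + 2 * j + 1)))]
  · unfold omega; ring
  · intro j hj
    have := Finset.ne_of_mem_erase hj
    rw [h1 _ (by omega) (by omega), h1 _ (by omega) (by omega)]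

theorem two_mul_apply_of_swap {ι : Type*} [DecidableEq ι]
    (L : MultilinearMap ℂ (fun _ : ι => (Fin 2 → ℂ)) ℂ) {u v : ι} (huv : u ≠ v)
    (h : ∀ x, L (x ∘ Equiv.swap u v) = - L x) (y : ι → Fin 2 → ℂ) :
    2 * L y = omega (y u) (y v) *
      (L (Function.update (Function.update y u (Pi.single 0 1)) v (Pi.single 1 1)) -
        L (Function.update (Function.update y u (Pi.single 1 1)) v (Pi.single 0 1))) := by
  let B : (Fin 2 → ℂ) →ₗ[ℂ] (Fin 2 → ℂ) →ₗ[ℂ] ℂ := LinearMap.mk₂ ℂ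
    (fun a b => L (Function.update (Function.update y u a) v b))
    (fun a a' b => by simp only [Function.update_comm huv, L.map_update_add])
    (fun c a b => by simp only [Function.update_comm huv, L.map_update_smul])
    (fun a b b' => L.map_update_add _ _ _ _)
    (fun c a b => L.map_update_smul _ _ _ _)
  have h1 := bilin_sub_swap B (y u) (y v)
  simp only [B, LinearMap.mk₂_apply, Function.update_eq_self] at h1
  rw [← h1, show Function.update (Function.update y u (y v)) v (y u) = y ∘ Equiv.swap u v from
    (Equiv.comp_swap_eq_update u v y).symm ▸ Function.update_comm huv _ _ _, h]
  ring

/-- Transposition identity for a form alternating in two arguments. -/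
theorem swap_add_swap {ι : Type*} [DecidableEq ι]
    (L : MultilinearMap ℂ (fun _ : ι => (Fin 2 → ℂ)) ℂ) {i u v : ι}
    (hiu : i ≠ u) (hiv : i ≠ v) (huv : u ≠ v)
    (h : ∀ x, L (x ∘ Equiv.swap u v) = - L x) (x : ι → Fin 2 → ℂ) :
    L (x ∘ Equiv.swap i u) + L (x ∘ Equiv.swap i v) = L x := by
  let g : (Fin 2 → ℂ) →ₗ[ℂ] ℂ :=
    L.toLinearMap (Function.update (Function.update x u (Pi.single 0 1)) v (Pi.single 1 1)) i -
    L.toLinearMap (Function.update (Function.update x u (Pi.single 1 1)) v (Pi.single 0 1)) i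
  have hg (y : ι → Fin 2 → ℂ) (hy : ∀ l, l ≠ i → l ≠ u → l ≠ v → y l = x l) :
      2 * L y = omega (y u) (y v) * g (y i) := by
    have hup (e f : Fin 2 → ℂ) : Function.update (Function.update y u e) v f =
        Function.update (Function.update (Function.update x u e) v f) i (y i) := by
      funext l
      by_cases h1 : l = i <;> by_cases h2 : l = u <;> by_cases h3 : l = v <;>
        simp_all
    rw [two_mul_apply_of_swap L huv h y, hup, hup]
    rfl
  have h0 := hg x fun _ _ _ _ => rfl
  have h1 := hg (x ∘ Equiv.swap i u) fun l hi hu _ => by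
    rw [Function.comp_apply, Equiv.swap_apply_of_ne_of_ne hi hu]
  have h2 := hg (x ∘ Equiv.swap i v) fun l hi _ hv => by
    rw [Function.comp_apply, Equiv.swap_apply_of_ne_of_ne hi hv]
  simp only [Function.comp_apply, Equiv.swap_apply_left, Equiv.swap_apply_right,
    Equiv.swap_apply_of_ne_of_ne hiv.symm huv.symm, Equiv.swap_apply_of_ne_of_ne hiu.symm huv]
    at h1 h2
  have hv : omega (x u) (x v) • x i = omega (x i) (x v) • x u + omega (x u) (x i) • x v := by
    ext t
    fin_cases t <;> simp [omega] <;> ring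
  have h3 := congrArg g hv
  simp only [map_add, map_smul, smul_eq_mul] at h3
  linear_combination (h1 + h2 - h0 - h3) / 2

theorem sum_range_add_two_mul (f : ℕ → ℂ) (k m : ℕ) :
    ∑ i ∈ Finset.range (k + 2 * m), f i = ∑ i ∈ Finset.range k, f i +
      ∑ p ∈ Finset.range m, (f (k + 2 * p) + f (k + 2 * p + 1)) := by
  induction m with
  | zero => simp
  | succ m ih =>
    rw [show k + 2 * (m + 1) = k + 2 * m + 1 + 1 by ring, Finset.sum_range_succ,
      Finset.sum_range_succ, ih, Finset.sum_range_succ]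
    ring

/-- Evaluation of the class sum of transpositions from its local identities. -/
theorem sum_sum_eq (S : ℕ → ℕ → ℂ) (c : ℂ) (k m : ℕ)
    (hsymm : ∀ i j, S i j = S j i) (hsmall : ∀ i < k, ∀ j < k, S i j = c)
    (hpair : ∀ i < k + 2 * m, ∀ p < m, i ≠ k + 2 * p → i ≠ k + 2 * p + 1 →
      S i (k + 2 * p) + S i (k + 2 * p + 1) = c)
    (hself : ∀ p < m, ∀ i, i = k + 2 * p ∨ i = k + 2 * p + 1 →
      S i (k + 2 * p) + S i (k + 2 * p + 1) = 0) :
    ∑ i ∈ Finset.range (k + 2 * m), ∑ j ∈ Finset.range (k + 2 * m), S i j =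
      (k ^ 2 + 2 * k * m + 2 * m ^ 2 - 2 * m) * c := by
  have h1 : ∀ i < k, ∑ j ∈ Finset.range (k + 2 * m), S i j = (k + m) * c := by
    intro i hi
    rw [sum_range_add_two_mul,
      Finset.sum_congr rfl (g := fun _ => c) fun j hj => hsmall i hi j (Finset.mem_range.1 hj),
      Finset.sum_congr rfl (g := fun _ => c) fun p hp =>
        hpair i (by omega) p (Finset.mem_range.1 hp) (by omega) (by omega)]
    simp only [Finset.sum_const, Finset.card_range, nsmul_eq_mul]
    ring
  have h2 : ∀ q < m, ∀ i, i = k + 2 * q ∨ i = k + 2 * q + 1 →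
      ∑ p ∈ Finset.range m, (S i (k + 2 * p) + S i (k + 2 * p + 1)) = (m - 1) * c := by
    intro q hq i hi
    rw [← Finset.add_sum_erase _ _ (Finset.mem_range.2 hq), hself q hq i hi,
      Finset.sum_congr rfl (g := fun _ => c)]
    · rw [Finset.sum_const, Finset.card_erase_of_mem (Finset.mem_range.2 hq), Finset.card_range,
        nsmul_eq_mul, Nat.cast_sub (by omega)]
      simp
    · intro p hp
      have h3 := Finset.ne_of_mem_erase hp
      have h4 := Finset.mem_range.1 (Finset.mem_of_mem_erase hp)
      exact hpair i (by omega) p h4 (by omega) (by omega)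
  have h3 : ∀ q < m, ∑ j ∈ Finset.range (k + 2 * m), S (k + 2 * q) j +
      ∑ j ∈ Finset.range (k + 2 * m), S (k + 2 * q + 1) j = (k + 2 * (m - 1)) * c := by
    intro q hq
    rw [sum_range_add_two_mul, sum_range_add_two_mul, h2 q hq _ (.inl rfl), h2 q hq _ (.inr rfl)]
    have : ∑ j ∈ Finset.range k, S (k + 2 * q) j + ∑ j ∈ Finset.range k, S (k + 2 * q + 1) j
        = k * c := by
      rw [← Finset.sum_add_distrib, Finset.sum_congr rfl (g := fun _ => c)]
      · simp
      · intro j hj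
        have hj := Finset.mem_range.1 hj
        rw [hsymm _ j, hsymm _ j]
        exact hpair j (by omega) q hq (by omega) (by omega)
    linear_combination this
  rw [sum_range_add_two_mul,
    Finset.sum_congr rfl (g := fun _ => (k + m) * c) fun i hi => h1 i (Finset.mem_range.1 hi),
    Finset.sum_congr rfl (g := fun _ => (k + 2 * (m - 1)) * c) fun i hi =>
      h3 i (Finset.mem_range.1 hi)]
  simp only [Finset.sum_const, Finset.card_range, nsmul_eq_mul]
  ring

/-- The sum of all the transposition operators, over ordered pairs of indices. -/
noncomputable def swapSum (n : ℕ) :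
    Module.End ℂ (MultilinearMap ℂ (fun _ : Fin n => (Fin 2 → ℂ)) ℂ) :=
  ∑ i : Fin n, ∑ j : Fin n,
    (MultilinearMap.domDomCongrLinearEquiv ℂ ℂ (Fin 2 → ℂ) ℂ (Equiv.swap i j)).toLinearMap

theorem swapSum_apply {n : ℕ} (L : MultilinearMap ℂ (fun _ : Fin n => (Fin 2 → ℂ)) ℂ)
    (x : Fin n → Fin 2 → ℂ) :
    swapSum n L x = ∑ i : Fin n, ∑ j : Fin n, L (x ∘ Equiv.swap i j) := by
  simp [swapSum, LinearMap.sum_apply, Function.comp_def]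

theorem swapSum_generator {n k m : ℕ} (hn : n = k + 2 * m)
    {L : MultilinearMap ℂ (fun _ : Fin n => (Fin 2 → ℂ)) ℂ} (hL : L ∈ generators n k) :
    swapSum n L = (k ^ 2 + 2 * k * m + 2 * m ^ 2 - 2 * m : ℂ) • L := by
  obtain ⟨σ, P, hP, hL⟩ := hL
  refine MultilinearMap.ext fun x => ?_
  rw [swapSum_apply, smul_apply, smul_eq_mul]
  have hk : k ≤ n := by omega
  have hconj (a b : Fin n) (x : Fin n → Fin 2 → ℂ) :
      L (x ∘ Equiv.swap (σ a) (σ b)) = prodForm k P ((x ∘ σ) ∘ Equiv.swap a b) := by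
    rw [hL]
    congr 1
    ext l : 1
    simp only [Function.comp_apply]
    rw [σ.injective.map_swap]
  have halt (p : ℕ) (hp : k + 2 * p + 1 < n) (x : Fin n → Fin 2 → ℂ) :
      L (x ∘ Equiv.swap (σ ⟨k + 2 * p, by omega⟩) (σ ⟨k + 2 * p + 1, hp⟩)) = - L x := by
    rw [hconj, prodForm_swap_pair, hL]
  let S (i j : ℕ) : ℂ := if h : i < n ∧ j < n then
    L (x ∘ Equiv.swap (σ ⟨i, h.1⟩) (σ ⟨j, h.2⟩)) else 0
  have hS (i j : ℕ) (hi : i < n) (hj : j < n) :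
      S i j = L (x ∘ Equiv.swap (σ ⟨i, hi⟩) (σ ⟨j, hj⟩)) := dif_pos ⟨hi, hj⟩
  have hsum : ∑ i : Fin n, ∑ j : Fin n, L (x ∘ Equiv.swap i j) =
      ∑ i ∈ Finset.range n, ∑ j ∈ Finset.range n, S i j := by
    rw [Finset.sum_range, ← Equiv.sum_comp σ]
    refine Finset.sum_congr rfl fun i _ => ?_
    rw [Finset.sum_range, ← Equiv.sum_comp σ]
    exact Finset.sum_congr rfl fun j _ => (hS i j i.2 j.2).symm
  rw [hsum]
  have := sum_sum_eq S (L x) k m ?_ ?_ ?_ ?_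
  · rwa [← hn] at this
  · intro i j
    by_cases h : i < n ∧ j < n
    · rw [hS _ _ h.1 h.2, hS _ _ h.2 h.1, Equiv.swap_comm]
    · simp only [S]
      rw [dif_neg h, dif_neg (by tauto)]
  · intro i hi j hj
    rw [hS _ _ (by omega) (by omega), hconj, hL]
    have := prodForm_comp_liftPerm hk P (Equiv.swap ⟨i, hi⟩ ⟨j, hj⟩) (x ∘ σ)
    rw [liftPerm_swap] at this
    refine this.trans ?_
    congr 1
    exact MultilinearMap.ext fun y => hP _ y
  · intro i hi p hp h1 h2
    rw [hS _ _ (by omega) (by omega), hS _ _ (by omega) (by omega)]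
    refine swap_add_swap L ?_ ?_ ?_ (halt p (by omega)) x <;>
      simp only [ne_eq, EmbeddingLike.apply_eq_iff_eq, Fin.mk.injEq] <;> omega
  · rintro p hp i (rfl | rfl)
    · rw [hS _ _ (by omega) (by omega), hS _ _ (by omega) (by omega), halt p (by omega)]
      simp
    · rw [hS _ _ (by omega) (by omega), hS _ _ (by omega) (by omega), Equiv.swap_comm,
        halt p (by omega)]
      simp

theorem iSupIndep_span_generators (n : ℕ) :
    iSupIndep (fun k : {k : ℕ // k ≤ n ∧ k % 2 = n % 2} =>
      Submodule.span ℂ (generators n k.1)) := by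
  let μ (k : {k : ℕ // k ≤ n ∧ k % 2 = n % 2}) : ℂ :=
    ((k.1 : ℂ) ^ 2 + 2 * k.1 * ((n - k.1) / 2 : ℕ) + 2 * ((n - k.1) / 2 : ℕ) ^ 2
      - 2 * ((n - k.1) / 2 : ℕ))
  have hμ : Function.Injective μ := by
    intro k l h
    have hμ' (k : {k : ℕ // k ≤ n ∧ k % 2 = n % 2}) :
        2 * μ k = (k.1 + 1) ^ 2 + (n ^ 2 - 2 * n - 1) := by
      have h : n = k.1 + 2 * ((n - k.1) / 2) := by have := k.2; omega
      have h' : (n : ℂ) = k.1 + 2 * ((n - k.1) / 2 : ℕ) := by exact_mod_cast h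
      simp only [μ, h']
      ring
    have h1 : ((k.1 : ℂ) + 1) ^ 2 = (l.1 + 1) ^ 2 := by
      linear_combination 2 * h - hμ' k + hμ' l
    have h2 : (k.1 + 1) ^ 2 = (l.1 + 1) ^ 2 := by exact_mod_cast h1
    have h3 := Nat.pow_left_injective two_ne_zero h2
    exact Subtype.ext (by simpa using h3)
  refine ((swapSum n).eigenspaces_iSupIndep.comp hμ).mono fun k => ?_
  rw [Submodule.span_le]
  intro L hL
  exact Module.End.mem_eigenspace_iff.2 (swapSum_generator (by have := k.2; omega) hL)

theorem exists_perm_apply_eq {α : Type*} [DecidableEq α] {a b i j : α} (hab : a ≠ b)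
    (hij : i ≠ j) : ∃ ρ : Equiv.Perm α, ρ a = i ∧ ρ b = j := by
  refine ⟨Equiv.swap a i * Equiv.swap b (Equiv.swap a i j), ?_, by simp⟩
  rw [Equiv.Perm.mul_apply, Equiv.swap_apply_of_ne_of_ne hab, Equiv.swap_apply_left]
  intro h
  have := congrArg (Equiv.swap a i) h
  simp at this
  exact hij this

theorem domDomCongr_conj_apply {n k : ℕ} (hk : k ≤ n) (σ : Equiv.Perm (Fin n))
    (τ : Equiv.Perm (Fin k)) (Q : MultilinearMap ℂ (fun _ : Fin k => (Fin 2 → ℂ)) ℂ)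
    (L : MultilinearMap ℂ (fun _ : Fin n => (Fin 2 → ℂ)) ℂ)
    (hL : ∀ x, L x = prodForm k Q (x ∘ σ)) (x : Fin n → Fin 2 → ℂ) :
    L.domDomCongr (σ * liftPerm hk τ * σ⁻¹) x = prodForm k (Q.domDomCongr τ) (x ∘ σ) := by
  rw [MultilinearMap.domDomCongr_apply, hL, ← prodForm_comp_liftPerm hk]
  congr 1
  ext l : 1
  simp

theorem sub_domDomCongr_mem {n k : ℕ} (hk : k ≤ n)
    (U : Submodule ℂ (MultilinearMap ℂ (fun _ : Fin n => (Fin 2 → ℂ)) ℂ))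
    (ih : ∀ k', k = k' + 2 → ∀ (σ : Equiv.Perm (Fin n))
      (Q : MultilinearMap ℂ (fun _ : Fin k' => (Fin 2 → ℂ)) ℂ)
      (L : MultilinearMap ℂ (fun _ : Fin n => (Fin 2 → ℂ)) ℂ),
      (∀ x, L x = prodForm k' Q (x ∘ σ)) → L ∈ U)
    (σ : Equiv.Perm (Fin n)) (τ : Equiv.Perm (Fin k))
    (Q : MultilinearMap ℂ (fun _ : Fin k => (Fin 2 → ℂ)) ℂ)
    (L : MultilinearMap ℂ (fun _ : Fin n => (Fin 2 → ℂ)) ℂ)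
    (hL : ∀ x, L x = prodForm k Q (x ∘ σ)) :
    L - L.domDomCongr (σ * liftPerm hk τ * σ⁻¹) ∈ U := by
  induction τ using Equiv.Perm.swap_induction_on with
  | one =>
    have : liftPerm hk 1 = 1 := by
      have := liftPerm_mul hk 1 1
      simpa using this
    rw [this]
    convert U.zero_mem
    refine MultilinearMap.ext fun x => ?_
    simp
  | swap_mul τ i j hij IH =>
    set L' := L.domDomCongr (σ * liftPerm hk τ * σ⁻¹) with hL'
    have h1 := domDomCongr_conj_apply hk σ τ Q L hL
    have h2 : L.domDomCongr (σ * liftPerm hk (Equiv.swap i j * τ) * σ⁻¹) =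
        L'.domDomCongr (σ * liftPerm hk (Equiv.swap i j) * σ⁻¹) := by
      rw [hL', ← MultilinearMap.domDomCongr_mul, liftPerm_mul]
      congr 1
      group
    rw [h2, ← sub_add_sub_cancel L L']
    refine U.add_mem IH ?_
    obtain ⟨k', rfl⟩ : ∃ k', k = k' + 2 :=
      ⟨k - 2, by have := i.isLt; have := j.isLt; have := Fin.val_ne_of_ne hij; omega⟩
    obtain ⟨ρ, rfl, rfl⟩ := exists_perm_apply_eq
      (a := (Fin.last k').castSucc) (b := Fin.last (k' + 1)) (Fin.castSucc_ne_last _) hij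
    refine ih k' rfl (σ * liftPerm hk ρ) (contract ((Q.domDomCongr τ).domDomCongr ρ⁻¹)) _
      fun x => ?_
    have h3 (R : MultilinearMap ℂ (fun _ : Fin (k' + 2) => (Fin 2 → ℂ)) ℂ) :
        prodForm (k' + 2) R (x ∘ (σ * liftPerm hk ρ : Equiv.Perm (Fin n))) =
          prodForm (k' + 2) (R.domDomCongr ρ) (x ∘ σ) :=
      prodForm_comp_liftPerm hk R ρ (x ∘ σ)
    rw [← prodForm_sub_swap hk, h3, h3, sub_apply,
      domDomCongr_conj_apply hk σ _ _ L' h1, h1]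
    simp only [← MultilinearMap.domDomCongr_mul]
    congr 3
    · simp
    · rw [Equiv.swap_apply_apply]
      group

theorem prodForm_mem {n : ℕ} (k : ℕ) (hk : k ≤ n) (hkn : k % 2 = n % 2)
    (σ : Equiv.Perm (Fin n)) (Q : MultilinearMap ℂ (fun _ : Fin k => (Fin 2 → ℂ)) ℂ)
    (L : MultilinearMap ℂ (fun _ : Fin n => (Fin 2 → ℂ)) ℂ)
    (hL : ∀ x, L x = prodForm k Q (x ∘ σ)) :
    L ∈ ⨆ k : {k : ℕ // k ≤ n ∧ k % 2 = n % 2}, Submodule.span ℂ (generators n k.1) := by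
  induction k using Nat.strong_induction_on generalizing σ L with
  | _ k ih =>
  set U := ⨆ k : {k : ℕ // k ≤ n ∧ k % 2 = n % 2}, Submodule.span ℂ (generators n k.1)
  have hsub (τ : Equiv.Perm (Fin k)) : L - L.domDomCongr (σ * liftPerm hk τ * σ⁻¹) ∈ U :=
    sub_domDomCongr_mem hk U
      (fun k' hk' σ Q L hL => ih k' (by omega) (by omega) (by omega) σ Q L hL) σ τ Q L hL
  have hf : ((k.factorial : ℕ) : ℂ) ≠ 0 := by exact_mod_cast k.factorial_ne_zero
  let N := ∑ τ : Equiv.Perm (Fin k), L.domDomCongr (σ * liftPerm hk τ * σ⁻¹)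
  let R := ∑ τ : Equiv.Perm (Fin k), Q.domDomCongr τ
  have hN : N ∈ U := by
    refine (le_iSup (fun k : {k : ℕ // k ≤ n ∧ k % 2 = n % 2} =>
      Submodule.span ℂ (generators n k.1)) ⟨k, hk, hkn⟩) (Submodule.subset_span ⟨σ, R, ?_, ?_⟩)
    · intro ρ y
      simp only [R, sum_apply, MultilinearMap.domDomCongr_apply]
      exact Equiv.sum_comp (Equiv.mulLeft ρ) (fun τ => Q fun i => y (τ i))
    · intro x
      simp only [N, R, sum_apply, domDomCongr_conj_apply hk σ _ Q L hL]
      simp only [prodForm, sum_apply, Finset.sum_mul]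
  have hdiff : (k.factorial : ℂ) • L - N ∈ U := by
    have := U.sum_mem (t := Finset.univ) fun τ _ => hsub τ
    rw [Finset.sum_sub_distrib, Finset.sum_const, Finset.card_univ, Fintype.card_perm,
      Fintype.card_fin, ← Nat.cast_smul_eq_nsmul ℂ] at this
    exact this
  have := U.add_mem hdiff hN
  rw [sub_add_cancel] at this
  exact (U.smul_mem_iff hf).1 this

end SymplecticMultilinear
/-- Lemma 6.2: the space of `n`-multilinear maps `(ℂ²)ⁿ → ℂ` is the internal direct sum,
over `0 ≤ k ≤ n` with `k ≡ n (mod 2)`, of the subspaces spanned by the maps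
`x ↦ P(x_{σ(1)},…,x_{σ(k)}) ω(x_{σ(k+1)},x_{σ(k+2)}) ⋯ ω(x_{σ(n-1)},x_{σ(n)})`
with `σ` a permutation and `P` a symmetric `k`-multilinear map. -/
theorem multilinear_isotypical_decomposition (n : ℕ) :
    DirectSum.IsInternal
      (fun k : {k : ℕ // k ≤ n ∧ k % 2 = n % 2} =>
        Submodule.span ℂ
          {L : MultilinearMap ℂ (fun _ : Fin n => (Fin 2 → ℂ)) ℂ |
            ∃ σ : Equiv.Perm (Fin n),
            ∃ P : MultilinearMap ℂ (fun _ : Fin k.1 => (Fin 2 → ℂ)) ℂ,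
              (∀ τ : Equiv.Perm (Fin k.1), ∀ y : Fin k.1 → (Fin 2 → ℂ), P (y ∘ τ) = P y) ∧
              ∀ x : Fin n → (Fin 2 → ℂ),
                L x = P (fun i => x (σ (Fin.castLE k.2.1 i))) *
                  ∏ j : Fin ((n - k.1) / 2),
                    (x (σ ⟨k.1 + 2 * j.1, by have := j.isLt; have := k.2.1; omega⟩) 0 *
                        x (σ ⟨k.1 + 2 * j.1 + 1, by have := j.isLt; have := k.2.1; omega⟩) 1 -
                      x (σ ⟨k.1 + 2 * j.1, by have := j.isLt; have := k.2.1; omega⟩) 1 *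
                        x (σ ⟨k.1 + 2 * j.1 + 1, by have := j.isLt; have := k.2.1; omega⟩) 0)}) := by

  have hset (k : {k : ℕ // k ≤ n ∧ k % 2 = n % 2}) : SymplecticMultilinear.generators n k.1 =
      {L | ∃ σ : Equiv.Perm (Fin n),
        ∃ P : MultilinearMap ℂ (fun _ : Fin k.1 => (Fin 2 → ℂ)) ℂ,
          (∀ τ : Equiv.Perm (Fin k.1), ∀ y : Fin k.1 → (Fin 2 → ℂ), P (y ∘ τ) = P y) ∧
          ∀ x : Fin n → (Fin 2 → ℂ),
            L x = P (fun i => x (σ (Fin.castLE k.2.1 i))) *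
              ∏ j : Fin ((n - k.1) / 2),
                (x (σ ⟨k.1 + 2 * j.1, by have := j.isLt; have := k.2.1; omega⟩) 0 *
                    x (σ ⟨k.1 + 2 * j.1 + 1, by have := j.isLt; have := k.2.1; omega⟩) 1 -
                  x (σ ⟨k.1 + 2 * j.1, by have := j.isLt; have := k.2.1; omega⟩) 1 *
                    x (σ ⟨k.1 + 2 * j.1 + 1, by have := j.isLt; have := k.2.1; omega⟩) 0)} := by
    have hk := k.2.1
    refine Set.ext fun L => exists_congr fun σ => exists_congr fun P => and_congr_right fun _ =>
      forall_congr' fun x => ?_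
    rw [SymplecticMultilinear.prodForm, Finset.prod_range]
    refine Eq.congr_right (congrArg₂ _ (congrArg P (funext fun i => ?_))
      (Finset.prod_congr rfl fun j _ => ?_))
    · exact SymplecticMultilinear.extend_of_lt _ (by omega)
    · rw [SymplecticMultilinear.extend_of_lt _ (by omega),
        SymplecticMultilinear.extend_of_lt _ (by omega)]
      rfl
  simp_rw [← hset]
  refine DirectSum.isInternal_submodule_of_iSupIndep_of_iSup_eq_top
    (SymplecticMultilinear.iSupIndep_span_generators n) (eq_top_iff.2 fun L _ => ?_)
  refine SymplecticMultilinear.prodForm_mem n le_rfl rfl 1 L L fun x => ?_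
  simp [SymplecticMultilinear.prodForm, SymplecticMultilinear.extend]
end

section
/- Let π be a group generated by elements t₁, …, tₙ. Let f be a complex-valued function on the set of group homomorphisms ρ : π → SL(2,ℂ) such that: (i) f is conjugation-invariant, i.e. f(g ρ g⁻¹) = f(ρ) for every g ∈ SL(2,ℂ) (where (g ρ g⁻¹)(s) = g ρ(s) g⁻¹); and (ii) there is a polynomial P in 4n variables with complex coefficients such that f(ρ) = P applied to the matrix entries of ρ(t₁), …, ρ(tₙ), for every ρ. Then f is a finite ℂ-linear combination of the functions χ_t, t ∈ π. -/
open MvPolynomial Matrix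

namespace CayleyOmega

/-- The polynomial ring in the entries of a generic `2 × 2` matrix. -/
abbrev Poly := MvPolynomial (Fin 2 × Fin 2) ℂ

/-- The polarization `f₀₀ g₁₁ + f₁₁ g₀₀ - f₀₁ g₁₀ - f₁₀ g₀₁` of Cayley's operator,
as a derivation in `g`. -/
noncomputable def bracket (f : Poly) : Derivation ℂ Poly Poly :=
  pderiv (0, 0) f • pderiv (1, 1) + pderiv (1, 1) f • pderiv (0, 0)
    - pderiv (0, 1) f • pderiv (1, 0) - pderiv (1, 0) f • pderiv (0, 1)

/-- Cayley's operator `∂₀₀ ∂₁₁ - ∂₀₁ ∂₁₀`. -/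
noncomputable def omega : Poly →ₗ[ℂ] Poly :=
  (pderiv (0, 0)).toLinearMap ∘ₗ (pderiv (1, 1)).toLinearMap
    - (pderiv (0, 1)).toLinearMap ∘ₗ (pderiv (1, 0)).toLinearMap

lemma bracket_apply (f g : Poly) :
    bracket f g = pderiv (0, 0) f * pderiv (1, 1) g + pderiv (1, 1) f * pderiv (0, 0) g
      - pderiv (0, 1) f * pderiv (1, 0) g - pderiv (1, 0) f * pderiv (0, 1) g := rfl

lemma omega_apply (f : Poly) :
    omega f = pderiv (0, 0) (pderiv (1, 1) f) - pderiv (0, 1) (pderiv (1, 0) f) := rfl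

lemma omega_mul (f g : Poly) :
    omega (f * g) = omega f * g + f * omega g + bracket f g := by
  simp only [omega_apply, bracket_apply, Derivation.leibniz, map_add, smul_eq_mul]
  ring

lemma omega_C_mul (c : ℂ) (f : Poly) : omega (C c * f) = C c * omega f := by
  rw [← smul_eq_C_mul, map_smul, smul_eq_C_mul]

/-- The standard symplectic matrix. -/
def symp : Matrix (Fin 2) (Fin 2) ℂ := !![0, 1; -1, 0]

/-- The bilinear form with matrix `A * symp`, evaluated on rows `i` and `j` of the generic
matrix. -/
noncomputable def form (A : Matrix (Fin 2) (Fin 2) ℂ) (i j : Fin 2) : Poly :=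
  C (A 0 0) * X (i, 0) * X (j, 1) - C (A 0 1) * X (i, 0) * X (j, 0)
    + C (A 1 0) * X (i, 1) * X (j, 1) - C (A 1 1) * X (i, 1) * X (j, 0)

lemma omega_form (A : Matrix (Fin 2) (Fin 2) ℂ) (i j : Fin 2) :
    omega (form A i j) = C (symp i j * A.trace) := by
  simp only [omega_apply, form]
  fin_cases i <;> fin_cases j <;>
    (simp [symp, Derivation.leibniz, Matrix.trace_fin_two]; try ring)

lemma bracket_form (A B : Matrix (Fin 2) (Fin 2) ℂ) (i j k l : Fin 2) :
    bracket (form A i j) (form B k l) =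
      symp i k • form (A.adjugate * B) j l + symp i l • form (B * A) k j
        - symp j k • form (A * B) i l + symp j l • form (A * B.adjugate) i k := by
  simp only [bracket_apply, form, smul_eq_C_mul]
  fin_cases i <;> fin_cases j <;> fin_cases k <;> fin_cases l <;>
    simp [symp, Matrix.adjugate_fin_two, Matrix.mul_apply, Fin.sum_univ_two] <;> ring

/-- The determinant of the generic matrix. -/
noncomputable abbrev genericDet : Poly := (mvPolynomialX (Fin 2) (Fin 2) ℂ).det

lemma form_one : form 1 0 1 = genericDet := by
  simp [form, Matrix.det_fin_two, mvPolynomialX_apply]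

lemma bracket_genericDet : bracket genericDet genericDet = 2 * genericDet := by
  rw [← form_one, bracket_form]
  simp [symp, form]
  ring

lemma omega_genericDet_pow_succ (k : ℕ) :
    omega (genericDet ^ (k + 1)) = C ((k + 1) * (k + 2) : ℂ) * genericDet ^ k := by
  induction k with
  | zero => rw [← form_one]; simp [omega_form, symp]
  | succ k ih =>
    rw [pow_succ', omega_mul, ih, Derivation.leibniz_pow, bracket_genericDet, ← form_one,
      omega_form]
    simp [symp, form_one]
    ring

lemma exists_omega_iterate_genericDet_pow (k : ℕ) :
    ∃ c : ℂ, c ≠ 0 ∧ (omega ^ k) (genericDet ^ k) = C c := by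
  induction k with
  | zero => exact ⟨1, one_ne_zero, by simp⟩
  | succ k ih =>
    obtain ⟨c, hc, h⟩ := ih
    refine ⟨(k + 1) * (k + 2) * c, ?_, ?_⟩
    · exact mul_ne_zero (mul_ne_zero (by exact_mod_cast k.succ_ne_zero)
        (by exact_mod_cast (k + 1).succ_ne_zero)) hc
    · rw [pow_succ omega, Module.End.mul_apply, omega_genericDet_pow_succ, ← smul_eq_C_mul,
        map_smul, h, smul_eq_C_mul, ← C_mul]

variable {π : Type*} [Group π]

/-- Families of polynomials indexed by the representations of `π` in `SL(2,ℂ)`. -/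
abbrev PolyFun (π : Type*) [Group π] := (π →* Matrix.SpecialLinearGroup (Fin 2) ℂ) → Poly

/-- The trace of `ρ s`, as a family of constant polynomials. -/
noncomputable def traceFun (s : π) : PolyFun π := fun ρ => C (ρ s).1.trace

/-- The family of forms attached to `ρ s`. -/
noncomputable def formFun (s : π) (i j : Fin 2) : PolyFun π := fun ρ => form (ρ s).1 i j

/-- The span of the trace functions. -/
noncomputable def traceSpan (π : Type*) [Group π] : Submodule ℂ (PolyFun π) :=
  Submodule.span ℂ (Set.range traceFun)

/-- The span of the families `formFun`. -/
noncomputable def formSpan (π : Type*) [Group π] : Submodule ℂ (PolyFun π) :=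
  Submodule.span ℂ (Set.range fun v : π × Fin 2 × Fin 2 => formFun v.1 v.2.1 v.2.2)

/-- Cayley's operator, applied pointwise. -/
noncomputable def omegaFun (π : Type*) [Group π] : PolyFun π →ₗ[ℂ] PolyFun π :=
  omega.compLeft _

/-- The bracket, applied pointwise. -/
noncomputable def bracketFun (f g : PolyFun π) : PolyFun π := fun ρ => bracket (f ρ) (g ρ)

lemma traceFun_mem (s : π) : traceFun s ∈ traceSpan π := Submodule.subset_span ⟨s, rfl⟩

lemma formFun_mem (s : π) (i j : Fin 2) : formFun s i j ∈ formSpan π :=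
  Submodule.subset_span ⟨(s, i, j), rfl⟩

lemma traceFun_mul (s r : π) :
    traceFun s * traceFun r = traceFun (s * r) + traceFun (s * r⁻¹) := by
  funext ρ
  simp only [traceFun, Pi.mul_apply, Pi.add_apply, map_mul, map_inv,
    Matrix.SpecialLinearGroup.coe_mul, Matrix.SpecialLinearGroup.coe_inv, Matrix.adjugate_fin_two,
    Matrix.trace_fin_two, Matrix.mul_apply, Fin.sum_univ_two]
  simp
  ring

lemma traceSpan_mul_le : traceSpan π * traceSpan π ≤ traceSpan π := by
  rw [traceSpan, Submodule.span_mul_span, Submodule.span_le]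
  rintro _ ⟨_, ⟨s, rfl⟩, _, ⟨r, rfl⟩, rfl⟩
  simp only [traceFun_mul]
  exact add_mem (traceFun_mem _) (traceFun_mem _)

lemma one_le_traceSpan : 1 ≤ traceSpan π := by
  rw [Submodule.one_le]
  have h : (1 : PolyFun π) = (2⁻¹ : ℂ) • traceFun 1 := by
    funext ρ
    simp [traceFun, smul_eq_C_mul, ← C_mul, -map_mul]
  rw [h]
  exact Submodule.smul_mem _ _ (traceFun_mem 1)

lemma omegaFun_mul (f g : PolyFun π) :
    omegaFun π (f * g) = omegaFun π f * g + f * omegaFun π g + bracketFun f g :=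
  funext fun ρ => omega_mul (f ρ) (g ρ)

lemma omegaFun_trace_mul {f : PolyFun π} (hf : f ∈ traceSpan π) (g : PolyFun π) :
    omegaFun π (f * g) = f * omegaFun π g := by
  induction hf using Submodule.span_induction with
  | mem _ h =>
    obtain ⟨s, rfl⟩ := h
    exact funext fun ρ => omega_C_mul _ _
  | zero => simp
  | add _ _ _ _ h₁ h₂ => simp only [add_mul, map_add, h₁, h₂]
  | smul c _ _ h => simp only [smul_mul_assoc, map_smul, h]

lemma omegaFun_mem_traceSpan {f : PolyFun π} (hf : f ∈ formSpan π) :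
    omegaFun π f ∈ traceSpan π := by
  induction hf using Submodule.span_induction with
  | mem _ h =>
    obtain ⟨⟨s, i, j⟩, rfl⟩ := h
    have h : omegaFun π (formFun s i j) = symp i j • traceFun s := by
      funext ρ
      change omega (form _ i j) = symp i j • C _
      rw [omega_form, C_mul, smul_eq_C_mul]
    rw [h]
    exact Submodule.smul_mem _ _ (traceFun_mem s)
  | zero => simp
  | add _ _ _ _ h₁ h₂ => rw [map_add]; exact add_mem h₁ h₂
  | smul c _ _ h => rw [map_smul]; exact Submodule.smul_mem _ _ h

lemma bracketFun_formFun_formFun (s r : π) (i j k l : Fin 2) :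
    bracketFun (formFun s i j) (formFun r k l) =
      symp i k • formFun (s⁻¹ * r) j l + symp i l • formFun (r * s) k j
        - symp j k • formFun (s * r) i l + symp j l • formFun (s * r⁻¹) i k := by
  funext ρ
  simp only [bracketFun, formFun, bracket_form, Pi.add_apply, Pi.sub_apply, Pi.smul_apply,
    map_mul, map_inv, Matrix.SpecialLinearGroup.coe_mul, Matrix.SpecialLinearGroup.coe_inv]

lemma bracketFun_add_left (f f' g : PolyFun π) :
    bracketFun (f + f') g = bracketFun f g + bracketFun f' g := by
  funext ρ
  simp only [bracketFun, bracket_apply, Pi.add_apply, map_add]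
  ring

lemma bracketFun_smul_left (c : ℂ) (f g : PolyFun π) :
    bracketFun (c • f) g = c • bracketFun f g := by
  funext ρ
  simp only [bracketFun, bracket_apply, Pi.smul_apply, Derivation.map_smul]
  simp only [smul_eq_C_mul]
  ring

lemma bracketFun_add_right (f g g' : PolyFun π) :
    bracketFun f (g + g') = bracketFun f g + bracketFun f g' :=
  funext fun ρ => map_add (bracket (f ρ)) _ _

lemma bracketFun_smul_right (c : ℂ) (f g : PolyFun π) :
    bracketFun f (c • g) = c • bracketFun f g :=
  funext fun ρ => (bracket (f ρ)).map_smul c (g ρ)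

lemma bracketFun_mul_right (f g g' : PolyFun π) :
    bracketFun f (g * g') = g * bracketFun f g' + g' * bracketFun f g :=
  funext fun ρ => (bracket (f ρ)).leibniz _ _

lemma bracketFun_mem_formSpan {f g : PolyFun π} (hf : f ∈ formSpan π) (hg : g ∈ formSpan π) :
    bracketFun f g ∈ formSpan π := by
  induction hf using Submodule.span_induction with
  | mem _ h =>
    obtain ⟨⟨s, i, j⟩, rfl⟩ := h
    induction hg using Submodule.span_induction with
    | mem _ h =>
      obtain ⟨⟨r, k, l⟩, rfl⟩ := h
      rw [bracketFun_formFun_formFun]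
      exact add_mem (sub_mem (add_mem (Submodule.smul_mem _ _ (formFun_mem _ _ _))
        (Submodule.smul_mem _ _ (formFun_mem _ _ _))) (Submodule.smul_mem _ _ (formFun_mem _ _ _)))
        (Submodule.smul_mem _ _ (formFun_mem _ _ _))
    | zero =>
      have h : bracketFun (formFun s i j) 0 = 0 := by
        simpa using bracketFun_smul_right 0 (formFun s i j) 0
      rw [h]; exact zero_mem _
    | add _ _ _ _ h₁ h₂ => rw [bracketFun_add_right]; exact add_mem h₁ h₂
    | smul c _ _ h => rw [bracketFun_smul_right]; exact Submodule.smul_mem _ _ h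
  | zero =>
    have h : bracketFun 0 g = 0 := by simpa using bracketFun_smul_left 0 0 g
    rw [h]; exact zero_mem _
  | add _ _ _ _ h₁ h₂ => rw [bracketFun_add_left]; exact add_mem h₁ h₂
  | smul c _ _ h => rw [bracketFun_smul_left]; exact Submodule.smul_mem _ _ h

lemma bracketFun_mem_formSpan_pow {f : PolyFun π} (hf : f ∈ formSpan π) (k : ℕ) {g : PolyFun π}
    (hg : g ∈ formSpan π ^ (k + 1)) : bracketFun f g ∈ formSpan π ^ (k + 1) := by
  induction k generalizing g with
  | zero => rw [zero_add, pow_one] at *; exact bracketFun_mem_formSpan hf hg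
  | succ k ih =>
    rw [pow_succ'] at hg
    induction hg using Submodule.mul_induction_on' with
    | mem_mul_mem a ha b hb =>
      rw [bracketFun_mul_right]
      refine add_mem ?_ ?_
      · rw [pow_succ']; exact Submodule.mul_mem_mul ha (ih hb)
      · rw [pow_succ]; exact Submodule.mul_mem_mul hb (bracketFun_mem_formSpan hf ha)
    | add _ _ _ _ h₁ h₂ => rw [bracketFun_add_right]; exact add_mem h₁ h₂

lemma omegaFun_mem_of_mem_formSpan_pow (k : ℕ) {f : PolyFun π} (hf : f ∈ formSpan π ^ (k + 1)) :
    omegaFun π f ∈ traceSpan π * formSpan π ^ k := by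
  induction k generalizing f with
  | zero => simpa using omegaFun_mem_traceSpan (by simpa using hf)
  | succ k ih =>
    rw [pow_succ'] at hf
    induction hf using Submodule.mul_induction_on' with
    | mem_mul_mem a ha b hb =>
      rw [omegaFun_mul]
      refine add_mem (add_mem ?_ ?_) ?_
      · exact Submodule.mul_mem_mul (omegaFun_mem_traceSpan ha) hb
      · rw [pow_succ', mul_left_comm]
        exact Submodule.mul_mem_mul ha (ih hb)
      · rw [← one_mul (bracketFun a b)]
        exact Submodule.mul_mem_mul (Submodule.one_le.1 one_le_traceSpan)
          (bracketFun_mem_formSpan_pow ha k hb)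
    | add _ _ _ _ h₁ h₂ => rw [map_add]; exact add_mem h₁ h₂

lemma omegaFun_mem (k : ℕ) {f : PolyFun π} (hf : f ∈ traceSpan π * formSpan π ^ (k + 1)) :
    omegaFun π f ∈ traceSpan π * formSpan π ^ k := by
  induction hf using Submodule.mul_induction_on' with
  | mem_mul_mem a ha b hb =>
    rw [omegaFun_trace_mul ha]
    have h := Submodule.mul_mem_mul ha (omegaFun_mem_of_mem_formSpan_pow k hb)
    rw [← mul_assoc] at h
    exact mul_le_mul_left traceSpan_mul_le _ h
  | add _ _ _ _ h₁ h₂ => rw [map_add]; exact add_mem h₁ h₂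

lemma omegaFun_iterate_mem (k : ℕ) {f : PolyFun π} (hf : f ∈ traceSpan π * formSpan π ^ k) :
    (omegaFun π ^ k) f ∈ traceSpan π := by
  induction k generalizing f with
  | zero => simpa using hf
  | succ k ih => rw [pow_succ, Module.End.mul_apply]; exact ih (omegaFun_mem k hf)

lemma omegaFun_iterate_apply (k : ℕ) (f : PolyFun π)
    (ρ : π →* Matrix.SpecialLinearGroup (Fin 2) ℂ) :
    (omegaFun π ^ k) f ρ = (omega ^ k) (f ρ) := by
  induction k generalizing f with
  | zero => rfl
  | succ k ih => rw [pow_succ, pow_succ, Module.End.mul_apply, Module.End.mul_apply, ih]; rfl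

/-- The matrix `M A M⁻¹`, where `M` has entries `x`, when `M` is invertible. -/
noncomputable def conjMatrix (x : Fin 2 × Fin 2 → ℂ) (A : Matrix (Fin 2) (Fin 2) ℂ) :
    Matrix (Fin 2) (Fin 2) ℂ :=
  (eval x genericDet)⁻¹ •
    ((of fun i j => x (i, j)) * A * (of fun i j => x (i, j) : Matrix _ _ ℂ).adjugate)

lemma exists_formFun_eval_eq (s : π) (i j : Fin 2) :
    ∃ q ∈ formSpan π, ∀ ρ : π →* Matrix.SpecialLinearGroup (Fin 2) ℂ, ∀ x,
      eval x genericDet ≠ 0 → eval x (q ρ) = eval x genericDet * conjMatrix x (ρ s).1 i j := by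
  have key : ∀ ρ : π →* Matrix.SpecialLinearGroup (Fin 2) ℂ, ∀ x, eval x genericDet ≠ 0 →
      eval x genericDet * conjMatrix x (ρ s).1 i j =
        if j = 0 then eval x (form (ρ s).1 i 1) else - eval x (form (ρ s).1 i 0) := by
    intro ρ x hx
    rw [conjMatrix, Matrix.smul_apply, smul_eq_mul, mul_inv_cancel_left₀ hx]
    fin_cases j <;>
      simp [form, Matrix.mul_apply, Fin.sum_univ_two, Matrix.adjugate_fin_two] <;> ring
  fin_cases j
  · exact ⟨formFun s i 1, formFun_mem _ _ _,
      fun ρ x hx => by simpa [formFun] using (key ρ x hx).symm⟩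
  · exact ⟨-formFun s i 0, neg_mem (formFun_mem _ _ _),
      fun ρ x hx => by simpa [formFun] using (key ρ x hx).symm⟩

lemma genericDet_mem : (fun _ => genericDet : PolyFun π) ∈ formSpan π := by
  have h : (fun _ => genericDet : PolyFun π) = formFun 1 0 1 := by
    funext ρ
    simp [formFun, ← form_one]
  rw [h]
  exact formFun_mem _ _ _

lemma exists_homogenization {n : ℕ} (t : Fin n → π)
    (P : MvPolynomial (Fin n × Fin 2 × Fin 2) ℂ) :
    ∃ d : ℕ, ∃ q ∈ formSpan π ^ d, ∀ ρ : π →* Matrix.SpecialLinearGroup (Fin 2) ℂ, ∀ x,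
      eval x genericDet ≠ 0 → eval x (q ρ) = eval x genericDet ^ d *
        eval (fun v => conjMatrix x (ρ (t v.1)).1 v.2.1 v.2.2) P := by
  induction P using MvPolynomial.induction_on with
  | C a =>
    refine ⟨0, a • 1, ?_, fun ρ x _ => by simp [smul_eq_C_mul]⟩
    rw [pow_zero]
    exact Submodule.smul_mem _ _ (Submodule.one_le.1 le_rfl)
  | add p₁ p₂ h₁ h₂ =>
    obtain ⟨d₁, q₁, hq₁, h₁⟩ := h₁
    obtain ⟨d₂, q₂, hq₂, h₂⟩ := h₂
    refine ⟨d₁ + d₂, q₁ * (fun _ => genericDet) ^ d₂ + (fun _ => genericDet) ^ d₁ * q₂, ?_, ?_⟩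
    · rw [pow_add]
      exact add_mem (Submodule.mul_mem_mul hq₁ (Submodule.pow_mem_pow _ genericDet_mem _))
        (Submodule.mul_mem_mul (Submodule.pow_mem_pow _ genericDet_mem _) hq₂)
    · intro ρ x hx
      simp only [Pi.add_apply, Pi.mul_apply, Pi.pow_apply, map_add, map_mul, map_pow,
        h₁ ρ x hx, h₂ ρ x hx]
      ring
  | mul_X p v h =>
    obtain ⟨d, q, hq, h⟩ := h
    obtain ⟨b, hb, hb'⟩ := exists_formFun_eval_eq (t v.1) v.2.1 v.2.2
    refine ⟨d + 1, q * b, ?_, ?_⟩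
    · rw [pow_succ]
      exact Submodule.mul_mem_mul hq hb
    · intro ρ x hx
      simp only [Pi.mul_apply, map_mul, h ρ x hx, hb' ρ x hx, eval_X]
      ring

lemma exists_conj_eq_conjMatrix (x : Fin 2 × Fin 2 → ℂ) (hx : eval x genericDet ≠ 0) :
    ∃ g : Matrix.SpecialLinearGroup (Fin 2) ℂ, ∀ A : Matrix.SpecialLinearGroup (Fin 2) ℂ,
      (MulAut.conj g A).1 = conjMatrix x A.1 := by
  obtain ⟨r, hr⟩ := IsAlgClosed.exists_eq_mul_self (eval x genericDet)
  set M : Matrix (Fin 2) (Fin 2) ℂ := of fun i j => x (i, j) with hM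
  have hdet : eval x genericDet = M.det := by
    simp [hM, Matrix.det_fin_two, mvPolynomialX_apply]
  have hr0 : r * r ≠ 0 := hr ▸ hx
  have hdet1 : (r⁻¹ • M).det = 1 := by
    rw [Matrix.det_smul, ← hdet, hr, Fintype.card_fin, pow_two, ← mul_inv, inv_mul_cancel₀ hr0]
  let g : Matrix.SpecialLinearGroup (Fin 2) ℂ := ⟨r⁻¹ • M, hdet1⟩
  have hg : g.1 = r⁻¹ • M := rfl
  refine ⟨g, fun A => ?_⟩
  rw [MulAut.conj_apply, Matrix.SpecialLinearGroup.coe_mul, Matrix.SpecialLinearGroup.coe_mul,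
    Matrix.SpecialLinearGroup.coe_inv, hg, conjMatrix, ← hM, hr, mul_inv]
  simp [Matrix.adjugate_smul, smul_smul]

end CayleyOmega

open CayleyOmega

/-- The coordinate ring of the `SL(2,ℂ)` character variety is spanned by trace functions:
any conjugation-invariant function on `Hom(π, SL(2,ℂ))` that is polynomial in the matrix
entries of the images of a generating set is a finite `ℂ`-linear combination of the
functions `χ_t : ρ ↦ -tr(ρ(t))`, `t ∈ π`. -/
theorem invariant_poly_is_trace_function (π : Type*) [Group π] (n : ℕ) (t : Fin n → π)
    (hgen : Subgroup.closure (Set.range t) = ⊤)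
    (f : (π →* Matrix.SpecialLinearGroup (Fin 2) ℂ) → ℂ)
    (hconj : ∀ g : Matrix.SpecialLinearGroup (Fin 2) ℂ,
      ∀ ρ : π →* Matrix.SpecialLinearGroup (Fin 2) ℂ,
        f ((MulAut.conj g).toMonoidHom.comp ρ) = f ρ)
    (hpoly : ∃ P : MvPolynomial (Fin n × Fin 2 × Fin 2) ℂ,
      ∀ ρ : π →* Matrix.SpecialLinearGroup (Fin 2) ℂ,
        f ρ = MvPolynomial.eval
          (fun v => ((ρ (t v.1) : Matrix.SpecialLinearGroup (Fin 2) ℂ) :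
            Matrix (Fin 2) (Fin 2) ℂ) v.2.1 v.2.2) P) :
    f ∈ Submodule.span ℂ
      (Set.range (fun s : π => fun ρ : π →* Matrix.SpecialLinearGroup (Fin 2) ℂ =>
        -Matrix.trace ((ρ s : Matrix.SpecialLinearGroup (Fin 2) ℂ) :
          Matrix (Fin 2) (Fin 2) ℂ))) := by
  obtain ⟨P, hP⟩ := hpoly
  obtain ⟨d, q, hq, h⟩ := exists_homogenization t P
  have hqρ : ∀ ρ, q ρ = f ρ • genericDet ^ d := by
    intro ρ
    refine mul_right_cancel₀ (det_mvPolynomialX_ne_zero (Fin 2) ℂ) (funext fun x => ?_)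
    by_cases hx : eval x genericDet = 0
    · simp only [map_mul, hx, mul_zero]
    · obtain ⟨g, hg⟩ := exists_conj_eq_conjMatrix x hx
      rw [map_mul, map_mul, h ρ x hx, ← hconj g ρ, hP, smul_eq_C_mul, map_mul, map_pow, eval_C]
      simp only [MonoidHom.comp_apply, MulEquiv.coe_toMonoidHom, hg]
      ring
  obtain ⟨c, hc, hcd⟩ := exists_omega_iterate_genericDet_pow d
  have hmem : (omegaFun π ^ d) q ∈ traceSpan π := omegaFun_iterate_mem d <| by
    rw [← one_mul q]
    exact Submodule.mul_mem_mul (Submodule.one_le.1 one_le_traceSpan) hq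
  have hf : f = c⁻¹ • (lcoeff ℂ 0).compLeft _ ((omegaFun π ^ d) q) := by
    funext ρ
    change f ρ = c⁻¹ * coeff 0 ((omegaFun π ^ d) q ρ)
    rw [omegaFun_iterate_apply, hqρ, map_smul, hcd, coeff_smul, coeff_zero_C, smul_eq_mul,
      mul_comm (f ρ), inv_mul_cancel_left₀ hc]
  rw [hf]
  refine Submodule.smul_mem _ _ ?_
  have hmap := Submodule.mem_map_of_mem (f := (lcoeff ℂ 0).compLeft _) hmem
  rw [traceSpan, Submodule.map_span] at hmap
  refine Submodule.span_le.2 ?_ hmap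
  rintro _ ⟨_, ⟨s, rfl⟩, rfl⟩
  have hs := neg_mem (Submodule.subset_span (R := ℂ) (Set.mem_range_self (f := fun s : π =>
    fun ρ : π →* Matrix.SpecialLinearGroup (Fin 2) ℂ => -Matrix.trace (ρ s).1) s))
  have heq : (lcoeff ℂ 0).compLeft _ (traceFun s) =
      -fun ρ : π →* Matrix.SpecialLinearGroup (Fin 2) ℂ => -Matrix.trace (ρ s).1 := by
    funext ρ
    change coeff 0 (C (ρ s).1.trace) = - -(ρ s).1.trace
    rw [coeff_zero_C, neg_neg]
  rw [heq]
  exact hs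
end
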